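/- For every 1 ≤ k ≤ n, every integer t ≥ 0 and every ρ ∈ S_k: ∑_{σ ∈ S_n : std(σ_{n−k+1},…,σ_n) = ρ} (Ksh_n)^t(id_n, σ) = (L_k)^t(id_k, ρ), where L_k is the S_k × S_k matrix L_k = ((n−k)/n)·Id + (k/n)·Ksh_k. That is, after t top-to-random shuffles of a deck of n distinct cards starting in ascending order, the standardisation of the bottommost k cards is distributed as t steps of an (n−k)/n-lazy top-to-random shuffle of a deck of k cards started in ascending order. -/

import Mathlib

open scoped Classical

noncomputable section

/-- The standardisation (rank function) of a word `w = (w 0, …, w (m-1))` of distinct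
letters from a linear order: position `a` is sent to the number of positions carrying a
smaller letter (so, `0`-indexed ranks). -/
def std {m : ℕ} {α : Type*} [LinearOrder α] (w : Fin m → α) : Fin m → Fin m :=
  fun a =>
    ⟨(Finset.univ.filter (fun b => w b < w a)).card, by
      have ha : a ∉ Finset.univ.filter (fun b => w b < w a) := by simp
      have h := Finset.card_lt_card
        ((Finset.ssubset_iff_of_subset (Finset.filter_subset _ _)).2
          ⟨a, Finset.mem_univ a, ha⟩)
      simpa using h⟩

/-- The top-to-random shuffle transition matrix on `S_m`:  `Ksh m σ τ = 1/m` if deleting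
the entry equal to `σ_1` (the top card) from the word `(τ_1, …, τ_m)` yields the word
`(σ_2, …, σ_m)`, and `0` otherwise. -/
def Ksh (m : ℕ) : Matrix (Equiv.Perm (Fin m)) (Equiv.Perm (Fin m)) ℝ :=
  Matrix.of fun σ τ =>
    if ∀ i : Fin (m - 1),
        (if (i : ℕ) < ((τ.symm (σ ⟨0, by have := i.isLt; omega⟩)) : ℕ)
          then τ ⟨(i : ℕ), by have := i.isLt; omega⟩
          else τ ⟨(i : ℕ) + 1, by have := i.isLt; omega⟩)
          = σ ⟨(i : ℕ) + 1, by have := i.isLt; omega⟩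
    then 1 / (m : ℝ) else 0


namespace Fin

theorem cycleRange_lt_cycleRange_iff {m : ℕ} (p x y : Fin m) :
    p.cycleRange x < p.cycleRange y ↔ y ≠ p ∧ (x = p ∨ x < y) := by
  rcases m with _ | m
  · exact p.elim0
  rcases Fin.eq_self_or_eq_succAbove p x with hx | ⟨i, rfl⟩ <;>
  rcases Fin.eq_self_or_eq_succAbove p y with hy | ⟨j, rfl⟩
  · simp [hx, hy]
  · simp [hx, Fin.succAbove_ne]
  · simp [hy]
  · simp [Fin.succAbove_ne]

end Fin

section Standardisation

variable {m : ℕ} {α β : Type*} [LinearOrder α] [LinearOrder β]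

theorem std_congr {w : Fin m → α} {v : Fin m → β} (h : ∀ a b, w b < w a ↔ v b < v a) :
    std w = std v := by
  funext a
  simp only [std, h]

theorem std_lt_std_iff (w : Fin m → α) (a b : Fin m) : std w a < std w b ↔ w a < w b := by
  have mono : ∀ {a b : Fin m}, w a ≤ w b → std w a ≤ std w b := fun h =>
    Fin.mk_le_mk.2 (Finset.card_le_card fun c hc => by
      simp only [Finset.mem_filter, Finset.mem_univ, true_and] at hc ⊢
      exact hc.trans_le h)
  refine ⟨fun h => lt_of_not_ge fun hba => h.not_ge (mono hba), fun h => ?_⟩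
  refine Fin.mk_lt_mk.2 (Finset.card_lt_card ?_)
  refine (Finset.ssubset_iff_of_subset fun c hc => ?_).2 ⟨a, by simpa using h, by simp⟩
  simp only [Finset.mem_filter, Finset.mem_univ, true_and] at hc ⊢
  exact hc.trans h

theorem std_injective {w : Fin m → α} (hw : Function.Injective w) :
    Function.Injective (std w) := fun a b h => by
  rcases lt_trichotomy (w a) (w b) with h' | h' | h'
  · exact absurd h ((std_lt_std_iff w a b).2 h').ne
  · exact hw h'
  · exact absurd h ((std_lt_std_iff w b a).2 h').ne'

theorem std_perm (ρ : Equiv.Perm (Fin m)) : std ρ = ρ := by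
  funext a
  apply Fin.ext
  have : Finset.univ.filter (fun b => ρ b < ρ a) = (Finset.Iio (ρ a)).map ρ.symm.toEmbedding := by
    ext b
    simp
  simp [std, this]

/-- The standardisation of a word with distinct letters, as a permutation. -/
def stdPerm (w : Fin m → α) (hw : Function.Injective w) : Equiv.Perm (Fin m) :=
  Equiv.ofBijective (std w) (Finite.injective_iff_bijective.1 (std_injective hw))

theorem std_cycleRange_comp_of_notMem {n : ℕ} {w : Fin m → Fin n} {p : Fin n}
    (hp : ∀ a, w a ≠ p) : std (fun a => p.cycleRange (w a)) = std w :=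
  std_congr fun a b => by simp [Fin.cycleRange_lt_cycleRange_iff, hp]

theorem std_cycleRange_comp_apply {n : ℕ} {w : Fin m → Fin n} (hw : Function.Injective w)
    (c : Fin m) : std (fun a => (w c).cycleRange (w a)) =
      ⇑((stdPerm w hw c).cycleRange * stdPerm w hw) := by
  rw [← std_perm ((stdPerm w hw c).cycleRange * stdPerm w hw)]
  refine std_congr fun a b => ?_
  simp [Fin.cycleRange_lt_cycleRange_iff, stdPerm, std_lt_std_iff, hw.eq_iff,
    (std_injective hw).eq_iff]

end Standardisation

section Shuffle

theorem Ksh_apply (m : ℕ) (hm : 1 ≤ m) (σ τ : Equiv.Perm (Fin m)) :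
    Ksh m σ τ = (m : ℝ)⁻¹ * ∑ p : Fin m, if τ = σ * p.cycleRange then 1 else 0 := by
  obtain ⟨m, rfl⟩ : ∃ m', m = m' + 1 := ⟨m - 1, by omega⟩
  have key : ∀ p : Fin (m + 1), τ = σ * p.cycleRange ↔
      τ.symm (σ 0) = p ∧ τ = σ * (τ.symm (σ 0)).cycleRange := by
    intro p
    constructor
    · intro h
      have : τ.symm (σ 0) = p := by
        rw [Equiv.symm_apply_eq, h]
        simp
      exact ⟨this, by rw [this]; exact h⟩
    · rintro ⟨h, h'⟩
      rw [h] at h'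
      exact h'
  have cond : (∀ i : Fin m,
      (if (i : ℕ) < ((τ.symm (σ 0)) : ℕ) then τ i.castSucc else τ i.succ) = σ i.succ) ↔
      τ = σ * (τ.symm (σ 0)).cycleRange := by
    generalize hp : τ.symm (σ 0) = p
    rw [Equiv.symm_apply_eq] at hp
    have sA : ∀ i : Fin m, (if (i : ℕ) < (p : ℕ) then τ i.castSucc else τ i.succ)
        = τ (p.succAbove i) := by
      intro i
      simp only [Fin.succAbove, Fin.lt_def, Fin.val_castSucc]
      split_ifs <;> rfl
    simp only [sA]
    constructor
    · intro h
      ext x : 1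
      rcases Fin.eq_self_or_eq_succAbove p x with rfl | ⟨i, rfl⟩
      · simp [hp]
      · simp [h]
    · intro h i
      rw [h]
      simp
  have : Ksh (m + 1) σ τ =
      if τ = σ * (τ.symm (σ 0)).cycleRange then 1 / ((m + 1 : ℕ) : ℝ) else 0 := by
    rw [← if_congr cond rfl rfl]
    rfl
  rw [this, Finset.sum_congr rfl fun p _ => if_congr (key p) rfl rfl]
  by_cases h : τ = σ * (τ.symm (σ 0)).cycleRange
  · rw [if_pos h]
    simp only [and_iff_left h]
    simp
  · rw [if_neg h]
    simp [h]

theorem sum_Ksh_mul (m : ℕ) (hm : 1 ≤ m) (σ : Equiv.Perm (Fin m))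
    (g : Equiv.Perm (Fin m) → ℝ) :
    ∑ τ, Ksh m σ τ * g τ = (m : ℝ)⁻¹ * ∑ p : Fin m, g (σ * p.cycleRange) := by
  simp_rw [Ksh_apply m hm, mul_assoc, ← Finset.mul_sum, Finset.sum_mul]
  rw [Finset.sum_comm]
  simp only [ite_mul, one_mul, zero_mul, Finset.sum_ite_eq', Finset.mem_univ, if_true]

theorem Ksh_mul_left (m : ℕ) (hm : 1 ≤ m) (g σ τ : Equiv.Perm (Fin m)) :
    Ksh m (g * σ) (g * τ) = Ksh m σ τ := by
  simp [Ksh_apply m hm, mul_assoc]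

end Shuffle

theorem Matrix.pow_apply_mul_left {G R : Type*} [Group G] [Fintype G] [DecidableEq G]
    [CommSemiring R] {M : Matrix G G R} (hM : ∀ g x y, M (g * x) (g * y) = M x y) (t : ℕ)
    (g x y : G) : (M ^ t) (g * x) (g * y) = (M ^ t) x y := by
  induction t generalizing x y with
  | zero => simp [Matrix.one_apply]
  | succ t ih =>
    simp only [pow_succ, Matrix.mul_apply]
    rw [← Equiv.sum_comp (Equiv.mulLeft g)]
    simp [ih, hM]

theorem Matrix.sum_pow_succ_one_mul {G R : Type*} [Group G] [Fintype G] [DecidableEq G]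
    [CommSemiring R] {M : Matrix G G R} (hM : ∀ g x y, M (g * x) (g * y) = M x y) (t : ℕ)
    (f : G → R) : ∑ x, (M ^ (t + 1)) 1 x * f x =
      ∑ x, (M ^ t) 1 x * ∑ y, M 1 y * f (y * x) := by
  have h : ∀ y, ∑ x, (M ^ t) y x * f x = ∑ x, (M ^ t) 1 x * f (y * x) := fun y => by
    rw [← Equiv.sum_comp (Equiv.mulLeft y)]
    refine Finset.sum_congr rfl fun x _ => ?_
    have := Matrix.pow_apply_mul_left hM t y 1 x
    rw [mul_one] at this
    simp [this]
  calc ∑ x, (M ^ (t + 1)) 1 x * f x = ∑ y, M 1 y * ∑ x, (M ^ t) y x * f x := by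
        simp only [pow_succ', Matrix.mul_apply, Finset.sum_mul, Finset.mul_sum, mul_assoc]
        exact Finset.sum_comm
    _ = _ := by
        simp only [h, Finset.mul_sum]
        rw [Finset.sum_comm]
        exact Finset.sum_congr rfl fun x _ => Finset.sum_congr rfl fun y _ => by ring

section Lumping

variable {n k : ℕ}

/-- The position, in a deck of `n` cards, of the `a`-th card among the bottommost `k`. -/
def bottomPos (hkn : k ≤ n) (a : Fin k) : Fin n :=
  (Fin.natAdd (n - k) a).cast (Nat.sub_add_cancel hkn)

theorem bottomPos_injective (hkn : k ≤ n) : Function.Injective (bottomPos hkn) := fun a b h => by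
  simpa [bottomPos, Fin.ext_iff] using h

/-- The standardisation of the bottommost `k` cards of a deck. -/
def bottomStd (hkn : k ≤ n) (σ : Equiv.Perm (Fin n)) : Equiv.Perm (Fin k) :=
  stdPerm (σ ∘ bottomPos hkn) (σ.injective.comp (bottomPos_injective hkn))

theorem bottomStd_cycleRange_bottomPos_mul (hkn : k ≤ n) (σ : Equiv.Perm (Fin n)) (a : Fin k) :
    bottomStd hkn ((σ (bottomPos hkn a)).cycleRange * σ) =
      (bottomStd hkn σ a).cycleRange * bottomStd hkn σ :=
  DFunLike.coe_injective
    (std_cycleRange_comp_apply (σ.injective.comp (bottomPos_injective hkn)) a)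

theorem bottomStd_cycleRange_mul_of_ne (hkn : k ≤ n) (σ : Equiv.Perm (Fin n)) {q : Fin n}
    (hq : ∀ a, bottomPos hkn a ≠ q) :
    bottomStd hkn ((σ q).cycleRange * σ) = bottomStd hkn σ :=
  DFunLike.coe_injective
    (std_cycleRange_comp_of_notMem (w := σ ∘ bottomPos hkn) fun a h => hq a (σ.injective h))

theorem bottomStd_one (hkn : k ≤ n) : bottomStd hkn 1 = 1 := by
  refine DFunLike.coe_injective ?_
  rw [← std_perm 1]
  exact std_congr fun a b => by simp [bottomPos]

theorem sum_bottomStd_cycleRange_mul (hkn : k ≤ n) (σ : Equiv.Perm (Fin n))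
    (g : Equiv.Perm (Fin k) → ℝ) :
    ∑ p : Fin n, g (bottomStd hkn (p.cycleRange * σ)) =
      ((n : ℝ) - k) * g (bottomStd hkn σ) +
        ∑ r : Fin k, g (r.cycleRange * bottomStd hkn σ) := by
  set B := Finset.univ.map ⟨bottomPos hkn, bottomPos_injective hkn⟩ with hB
  rw [← Equiv.sum_comp σ, ← Finset.sum_compl_add_sum B]
  congr 1
  · have hcard : ((Bᶜ).card : ℝ) = (n : ℝ) - k := by
      rw [Finset.card_compl, hB, Finset.card_map]
      simp [Nat.cast_sub hkn]
    rw [← hcard, ← nsmul_eq_mul]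
    refine Finset.sum_eq_card_nsmul fun q hq => ?_
    rw [bottomStd_cycleRange_mul_of_ne]
    simpa [hB] using hq
  · rw [hB, Finset.sum_map, ← Equiv.sum_comp (bottomStd hkn σ) fun r => g (r.cycleRange * bottomStd hkn σ)]
    simp [bottomStd_cycleRange_bottomPos_mul]

theorem sum_Ksh_pow_bottomStd (hk : 1 ≤ k) (hkn : k ≤ n) (t : ℕ)
    (g : Equiv.Perm (Fin k) → ℝ) :
    ∑ σ, (Ksh n ^ t) 1 σ * g (bottomStd hkn σ) =
      ∑ ρ, (((((n : ℝ) - (k : ℝ)) / (n : ℝ)) •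
          (1 : Matrix (Equiv.Perm (Fin k)) (Equiv.Perm (Fin k)) ℝ)
        + ((k : ℝ) / (n : ℝ)) • Ksh k) ^ t) 1 ρ * g ρ := by
  induction t generalizing g with
  | zero => simp [Matrix.one_apply, bottomStd_one]
  | succ t ih =>
    have hk0 : (k : ℝ) ≠ 0 := by positivity
    rw [Matrix.sum_pow_succ_one_mul (Ksh_mul_left n (hk.trans hkn)),
      Matrix.sum_pow_succ_one_mul fun h x y => by simp [Ksh_mul_left k hk, Matrix.one_apply],
      ← ih]
    refine Finset.sum_congr rfl fun σ _ => congrArg _ ?_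
    rw [sum_Ksh_mul n (hk.trans hkn) 1 fun τ => g (bottomStd hkn (τ * σ))]
    simp only [Matrix.add_apply, Matrix.smul_apply, smul_eq_mul, add_mul, Finset.sum_add_distrib,
      mul_assoc, ← Finset.mul_sum]
    rw [sum_Ksh_mul k hk 1 fun τ => g (τ * bottomStd hkn σ)]
    simp only [one_mul, sum_bottomStd_cycleRange_mul, Matrix.one_apply]
    simp
    field_simp

end Lumping

/-- **Distribution of the bottommost `k` cards under top-to-random shuffles.**  After `t`
top-to-random shuffles of a deck of `n` distinct cards starting in ascending order, the
standardisation of the bottommost `k` cards is distributed as `t` steps of the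
`(n-k)/n`-lazy top-to-random shuffle of a deck of `k` cards started in ascending order. -/
theorem topToRandom_bottom_k_distribution (n k : ℕ) (hk1 : 1 ≤ k) (hkn : k ≤ n)
    (t : ℕ) (ρ : Equiv.Perm (Fin k)) :
    ∑ σ ∈ Finset.univ.filter (fun σ : Equiv.Perm (Fin n) =>
        std (fun a : Fin k => σ ⟨n - k + (a : ℕ), by have := a.isLt; omega⟩) = ⇑ρ),
      (Ksh n ^ t) 1 σ
    = (((((n : ℝ) - (k : ℝ)) / (n : ℝ)) •
          (1 : Matrix (Equiv.Perm (Fin k)) (Equiv.Perm (Fin k)) ℝ)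
        + ((k : ℝ) / (n : ℝ)) • Ksh k) ^ t) 1 ρ := by
  rw [Finset.sum_filter]
  have h := sum_Ksh_pow_bottomStd hk1 hkn t fun τ => if τ = ρ then 1 else 0
  simp only [mul_ite, mul_one, mul_zero, Finset.sum_ite_eq', Finset.mem_univ, if_true] at h
  rw [← h]
  refine Finset.sum_congr rfl fun σ _ => if_congr ?_ rfl rfl
  exact DFunLike.coe_fn_eq (f := bottomStd hkn σ)

end
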